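/- arXiv:1807.11364 — 7 statements merged into one kernel-verified Lean document; each statement's English description precedes it below -/
import Mathlib

section
/- A sharp homomorphism of valuative monoids is an isomorphism if and only if it induces an isomorphism on associated groups: let G be an additive commutative group and N ⊆ M ⊆ G submonoids, each of which is valuative with respect to the subgroup of G it generates (for every x in the subgroup generated by the submonoid, either x or −x lies in the submonoid). Suppose the inclusion N ⊆ M is sharp, i.e., every invertible element of M (every x with x ∈ M and −x ∈ M) lies in N. Then N = M if and only if N and M generate the same subgroup of G. -/
/-- A sharp homomorphism of valuative monoids is an isomorphism if and only if
it induces an isomorphism on associated groups: for valuative submonoids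
`N ⊆ M` of `G` with sharp inclusion, `N = M` iff `N` and `M` generate the same
subgroup of `G`. -/
theorem sharp_valuative_iso_iff_group_iso {G : Type*} [AddCommGroup G]
    (N M : AddSubmonoid G) (hNM : N ≤ M)
    (hNval : ∀ x ∈ AddSubgroup.closure (N : Set G), x ∈ N ∨ -x ∈ N)
    (hMval : ∀ x ∈ AddSubgroup.closure (M : Set G), x ∈ M ∨ -x ∈ M)
    (hsharp : ∀ x ∈ M, -x ∈ M → x ∈ N) :
    N = M ↔ AddSubgroup.closure (N : Set G) = AddSubgroup.closure (M : Set G) := by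
  refine ⟨fun h => by rw [h], fun h => le_antisymm hNM fun x hx => ?_⟩
  have hx' : x ∈ AddSubgroup.closure (N : Set G) := h ▸ AddSubgroup.subset_closure hx
  exact (hNval x hx').elim id fun hneg => hsharp x hx (hNM hneg)
end

section
/- Any partial order on an abelian group can be extended to a total order: let G be an additive commutative group and M ⊆ G a submonoid which is sharp (M ∩ (−M) = {0}) and saturated (for every x ∈ G and every integer n ≥ 1, n•x ∈ M implies x ∈ M). Then there exists a submonoid N of G with M ⊆ N, N ∩ (−N) = {0}, and N ∪ (−N) = G. Equivalently, the translation-invariant partial order on G with positive cone M extends to a translation-invariant total order. -/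
/-- A submonoid is a saturated positive cone if it is sharp and saturated. -/
structure AddSubmonoid.IsSaturatedCone {G : Type*} [AddCommGroup G] (N : AddSubmonoid G) :
    Prop where
  sharp : ∀ x ∈ N, -x ∈ N → x = 0
  saturated : ∀ x : G, ∀ n : ℕ, 0 < n → n • x ∈ N → x ∈ N

/-- The saturation of the submonoid generated by `N` and `x`. -/
def AddSubmonoid.saturatedAdjoin {G : Type*} [AddCommGroup G] (N : AddSubmonoid G) (x : G) :
    AddSubmonoid G where
  carrier := {y | ∃ n k : ℕ, 0 < n ∧ ∃ m ∈ N, n • y = m + k • x}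
  zero_mem' := ⟨1, 0, one_pos, 0, N.zero_mem, by simp⟩
  add_mem' := by
    rintro a b ⟨n, k, hn, m, hm, h⟩ ⟨n', k', hn', m', hm', h'⟩
    refine ⟨n' * n, n' * k + n * k', Nat.mul_pos hn' hn, n' • m + n • m',
      N.add_mem (N.nsmul_mem hm _) (N.nsmul_mem hm' _), ?_⟩
    calc (n' * n) • (a + b) = n' • (n • a) + n • (n' • b) := by module
      _ = _ := by rw [h, h']; module

lemma AddSubmonoid.le_saturatedAdjoin {G : Type*} [AddCommGroup G] (N : AddSubmonoid G) (x : G) :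
    N ≤ N.saturatedAdjoin x :=
  fun y hy => ⟨1, 0, one_pos, y, hy, by simp⟩

lemma AddSubmonoid.mem_saturatedAdjoin_self {G : Type*} [AddCommGroup G] (N : AddSubmonoid G)
    (x : G) : x ∈ N.saturatedAdjoin x :=
  ⟨1, 1, one_pos, 0, N.zero_mem, by simp⟩

lemma AddSubmonoid.IsSaturatedCone.saturatedAdjoin {G : Type*} [AddCommGroup G]
    {N : AddSubmonoid G} (hN : N.IsSaturatedCone) {x : G} (hx : -x ∉ N) :
    (N.saturatedAdjoin x).IsSaturatedCone where
  sharp := by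
    rintro y ⟨n, k, hn, m, hm, h⟩ ⟨n', k', hn', m', hm', h'⟩
    have key : (n' * k + n * k') • (-x) = n' • m + n • m' := by
      have hm_eq : m = n • y - k • x := eq_sub_of_add_eq h.symm
      have hm'_eq : m' = n' • (-y) - k' • x := eq_sub_of_add_eq h'.symm
      rw [hm_eq, hm'_eq]
      module
    have hzero : n' * k + n * k' = 0 := by
      by_contra hne
      refine hx (hN.saturated _ _ (Nat.pos_of_ne_zero hne) ?_)
      rw [key]
      exact N.add_mem (N.nsmul_mem hm _) (N.nsmul_mem hm' _)
    obtain ⟨hk, hk'⟩ := Nat.add_eq_zero_iff.mp hzero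
    obtain rfl : k = 0 := (Nat.mul_eq_zero.mp hk).resolve_left hn'.ne'
    obtain rfl : k' = 0 := (Nat.mul_eq_zero.mp hk').resolve_left hn.ne'
    rw [zero_nsmul, add_zero] at h h'
    exact hN.sharp y (hN.saturated _ n hn (h ▸ hm)) (hN.saturated _ n' hn' (h' ▸ hm'))
  saturated := by
    rintro y l hl ⟨n, k, hn, m, hm, h⟩
    exact ⟨n * l, k, Nat.mul_pos hn hl, m, hm, by rw [mul_nsmul', h]⟩

lemma AddSubmonoid.isSaturatedCone_sSup_of_isChain {G : Type*} [AddCommGroup G]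
    {c : Set (AddSubmonoid G)} (hc : IsChain (· ≤ ·) c) (hne : c.Nonempty)
    (h : ∀ N ∈ c, N.IsSaturatedCone) : (sSup c).IsSaturatedCone where
  sharp := by
    intro x hx hx'
    rw [AddSubmonoid.mem_sSup_of_directedOn hne hc.directedOn] at hx hx'
    obtain ⟨A, hA, hxA⟩ := hx
    obtain ⟨B, hB, hxB⟩ := hx'
    obtain ⟨C, hC, hAC, hBC⟩ := hc.directedOn A hA B hB
    exact (h C hC).sharp x (hAC hxA) (hBC hxB)
  saturated := by
    intro x n hn hx
    rw [AddSubmonoid.mem_sSup_of_directedOn hne hc.directedOn] at hx ⊢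
    obtain ⟨A, hA, hxA⟩ := hx
    exact ⟨A, hA, (h A hA).saturated x n hn hxA⟩

/-- Any partial order on an abelian group can be extended to a total order:
if `M` is a sharp, saturated submonoid of an additive commutative group `G`,
then there is a submonoid `N ⊇ M` which is sharp and satisfies `N ∪ (-N) = G`,
i.e. the translation-invariant partial order with positive cone `M` extends to
a translation-invariant total order. -/
theorem partial_order_extends_to_total_order {G : Type*} [AddCommGroup G]
    (M : AddSubmonoid G)
    (hsharp : ∀ x ∈ M, -x ∈ M → x = 0)
    (hsat : ∀ x : G, ∀ n : ℤ, 1 ≤ n → n • x ∈ M → x ∈ M) :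
    ∃ N : AddSubmonoid G, M ≤ N ∧ (∀ x ∈ N, -x ∈ N → x = 0) ∧ ∀ x : G, x ∈ N ∨ -x ∈ N := by
  have hM : M.IsSaturatedCone :=
    ⟨hsharp, fun x n hn hx => hsat x n (by exact_mod_cast hn) (by rwa [natCast_zsmul])⟩
  obtain ⟨N, hMN, hN⟩ := zorn_le_nonempty₀ {N : AddSubmonoid G | N.IsSaturatedCone}
    (fun c hcs hc y hy => ⟨sSup c, AddSubmonoid.isSaturatedCone_sSup_of_isChain hc ⟨y, hy⟩
      fun N hN => hcs hN, fun _ hz => le_sSup hz⟩) M hM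
  refine ⟨N, hMN, hN.prop.sharp, fun x => or_iff_not_imp_right.mpr fun hx => ?_⟩
  exact hN.le_of_ge (AddSubmonoid.IsSaturatedCone.saturatedAdjoin hN.prop hx)
    (N.le_saturatedAdjoin x) (N.mem_saturatedAdjoin_self x)
end

section
/- The elements bounded by δ are precisely the units of M adjoined −δ: let G be an additive commutative group, M ⊆ G a submonoid, and δ ∈ M. Write x ≤_M y to mean y − x ∈ M, and let M[−δ] denote the submonoid of G generated by M ∪ {−δ}. Then for every α ∈ G, there exist integers m, n with m•δ ≤_M α and α ≤_M n•δ if and only if both α ∈ M[−δ] and −α ∈ M[−δ]. -/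
/-- Membership in `M[-δ]`: some integer multiple of `δ` moves the element into `M`. -/
theorem AddSubmonoid.mem_closure_union_neg_singleton_iff {G : Type*} [AddCommGroup G]
    {M : AddSubmonoid G} {δ : G} (hδ : δ ∈ M) {x : G} :
    x ∈ AddSubmonoid.closure ((M : Set G) ∪ {-δ}) ↔ ∃ k : ℤ, x + k • δ ∈ M := by
  rw [AddSubmonoid.closure_union, AddSubmonoid.closure_eq, AddSubmonoid.mem_sup]
  simp only [AddSubmonoid.mem_closure_singleton]
  constructor
  · rintro ⟨y, hy, _, ⟨n, rfl⟩, rfl⟩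
    exact ⟨n, by simpa using hy⟩
  · rintro ⟨k, hk⟩
    obtain ⟨n, rfl | rfl⟩ := k.eq_nat_or_neg
    · exact ⟨_, hk, _, ⟨n, rfl⟩, by simp⟩
    · refine ⟨x, ?_, 0, ⟨0, zero_nsmul _⟩, add_zero x⟩
      simpa using M.add_mem hk (M.nsmul_mem hδ n)

/-- The elements bounded by `δ` are precisely the units of `M[-δ]`: for a
submonoid `M` of an additive commutative group `G` and `δ ∈ M`, an element
`α ∈ G` satisfies `m • δ ≤_M α ≤_M n • δ` for some integers `m, n` (where
`x ≤_M y` means `y - x ∈ M`) if and only if both `α` and `-α` lie in the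
submonoid generated by `M` and `-δ`. -/
theorem bounded_iff_unit_of_adjoin {G : Type*} [AddCommGroup G] (M : AddSubmonoid G)
    (δ : G) (hδ : δ ∈ M) :
    ∀ α : G, (∃ m n : ℤ, α - m • δ ∈ M ∧ n • δ - α ∈ M) ↔
      (α ∈ AddSubmonoid.closure ((M : Set G) ∪ {-δ}) ∧
        -α ∈ AddSubmonoid.closure ((M : Set G) ∪ {-δ})) := by
  intro α
  rw [AddSubmonoid.mem_closure_union_neg_singleton_iff hδ,
    AddSubmonoid.mem_closure_union_neg_singleton_iff hδ]
  constructor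
  · rintro ⟨m, n, hm, hn⟩
    exact ⟨⟨-m, by rwa [neg_smul, ← sub_eq_add_neg]⟩, ⟨n, by rwa [neg_add_eq_sub]⟩⟩
  · rintro ⟨⟨k, hk⟩, ⟨n, hn⟩⟩
    exact ⟨-k, n, by rwa [neg_smul, sub_neg_eq_add], by rwa [← neg_add_eq_sub]⟩
end

section
/- Gross–Siebert description of the characteristic monoid at a node: let G be an additive commutative group, M ⊆ G a submonoid, and δ ∈ M. Then the submonoid of G × G generated by the diagonal {(m, m) : m ∈ M} together with the two elements (0, δ) and (δ, 0) is equal to {(a, b) ∈ G × G : a ∈ M, b ∈ M, and b − a ∈ ℤ•δ}, i.e., the set of pairs (a,b) of elements of M whose difference is an integer multiple of δ. (This identifies the pushout monoid M + ℕα + ℕβ with the relation α + β = δ, via α ↦ (0, δ), β ↦ (δ, 0), γ ↦ (γ, γ).) -/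
/-- Gross–Siebert description of the characteristic monoid at a node: for a
submonoid `M` of an additive commutative group `G` and `δ ∈ M`, the submonoid of
`G × G` generated by the diagonal copy of `M` together with `(0, δ)` and
`(δ, 0)` equals the set of pairs `(a, b)` of elements of `M` whose difference
is an integer multiple of `δ`.  (This identifies the pushout monoid
`M + ℕα + ℕβ / (α + β = δ)` via `α ↦ (0, δ)`, `β ↦ (δ, 0)`, `γ ↦ (γ, γ)`.) -/
theorem gross_siebert_node_monoid {G : Type*} [AddCommGroup G] (M : AddSubmonoid G)
    (δ : G) (hδ : δ ∈ M) :
    (AddSubmonoid.closure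
        ((fun m => (m, m)) '' (M : Set G) ∪ {((0 : G), δ), (δ, (0 : G))}) : Set (G × G)) =
      { p : G × G | p.1 ∈ M ∧ p.2 ∈ M ∧ ∃ k : ℤ, p.2 - p.1 = k • δ } := by
  ext p
  simp only [SetLike.mem_coe, Set.mem_ofPred_eq]
  constructor
  · intro h
    induction h using AddSubmonoid.closure_induction with
    | mem x hx =>
      rcases hx with ⟨m, hm, rfl⟩ | rfl | rfl
      · exact ⟨hm, hm, 0, by simp⟩
      · exact ⟨M.zero_mem, hδ, 1, by simp⟩
      · exact ⟨hδ, M.zero_mem, -1, by simp⟩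
    | zero => exact ⟨M.zero_mem, M.zero_mem, 0, by simp⟩
    | add x y _ _ hx hy =>
      obtain ⟨hx₁, hx₂, k, hk⟩ := hx
      obtain ⟨hy₁, hy₂, l, hl⟩ := hy
      refine ⟨M.add_mem hx₁ hy₁, M.add_mem hx₂ hy₂, k + l, ?_⟩
      rw [add_smul, ← hk, ← hl, Prod.fst_add, Prod.snd_add, add_sub_add_comm]
  · obtain ⟨a, b⟩ := p
    rintro ⟨ha, hb, k, hk⟩
    obtain ⟨n, rfl | rfl⟩ := k.eq_nat_or_neg
    · have hab : (a, b) = (a, a) + n • ((0 : G), δ) := by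
        ext
        · simp
        · simpa [sub_eq_iff_eq_add'] using hk
      rw [hab]
      refine add_mem (AddSubmonoid.mem_closure_of_mem ?_)
        (nsmul_mem (AddSubmonoid.mem_closure_of_mem ?_) n)
      · exact Or.inl ⟨a, ha, rfl⟩
      · exact Or.inr (by simp)
    · have hab : (a, b) = (b, b) + n • (δ, (0 : G)) := by
        ext
        · rw [neg_smul, natCast_zsmul, ← neg_sub, neg_inj, sub_eq_iff_eq_add'] at hk
          simpa using hk
        · simp
      rw [hab]
      refine add_mem (AddSubmonoid.mem_closure_of_mem ?_)
        (nsmul_mem (AddSubmonoid.mem_closure_of_mem ?_) n)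
      · exact Or.inl ⟨b, hb, rfl⟩
      · exact Or.inr (by simp)
end

section
/- The bounded monodromy condition coincides with the Kajiwara–Kato–Nakayama condition: let G be an additive commutative group, M ⊆ G a submonoid (write x ≤_M y for y − x ∈ M), E a finite set, δ : E → M an assignment of edge lengths, A a subgroup of the group of functions E → ℤ, and ⟨x, y⟩ = ∑_{e ∈ E} (x(e) · y(e)) • δ(e) ∈ G the associated intersection pairing. Then for an additive homomorphism φ : A → G, the following are equivalent: (1) for every x ∈ A there exist integers m, n with m•⟨x, x⟩ ≤_M φ(x) and φ(x) ≤_M n•⟨x, x⟩; (2) for every x ∈ A there exist y, y' ∈ A with ⟨x, y⟩ ≤_M φ(x) and φ(x) ≤_M ⟨x, y'⟩. -/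
/-- If the edge lengths lie in a submonoid `M`, then every `⟨x, y⟩` is bounded above, in the
preorder defined by `M`, by an integer multiple of `⟨x, x⟩`. -/
theorem exists_zsmul_sum_mul_self_sub_mem {G E : Type*} [AddCommGroup G] [Fintype E]
    (M : AddSubmonoid G) (δ : E → G) (hδ : ∀ e, δ e ∈ M) (x y : E → ℤ) :
    ∃ n : ℤ, n • (∑ e, (x e * x e) • δ e) - ∑ e, (x e * y e) • δ e ∈ M := by
  refine ⟨∑ e, |y e|, ?_⟩
  rw [Finset.smul_sum, ← Finset.sum_sub_distrib]
  refine sum_mem fun e _ => ?_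
  rw [smul_smul, ← sub_smul]
  have hy : |y e| ≤ ∑ e, |y e| :=
    Finset.single_le_sum (f := fun e => |y e|) (fun i _ => abs_nonneg _) (Finset.mem_univ e)
  have hx : |x e| ≤ x e * x e := by
    rw [← abs_mul_abs_self (x e)]
    rcases (abs_nonneg (x e)).eq_or_lt with h | h
    · simp [← h]
    · nlinarith
  have hxy : x e * y e ≤ (∑ e, |y e|) * (x e * x e) :=
    calc x e * y e ≤ |y e| * |x e| := by rw [mul_comm, ← abs_mul]; exact le_abs_self _
      _ ≤ (∑ e, |y e|) * (x e * x e) :=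
        mul_le_mul hy hx (abs_nonneg _) ((abs_nonneg _).trans hy)
  obtain ⟨k, hk⟩ := Int.eq_ofNat_of_zero_le (sub_nonneg.2 hxy)
  rw [hk, natCast_zsmul]
  exact nsmul_mem (hδ e) k


/-- The bounded monodromy condition coincides with the Kajiwara–Kato–Nakayama
condition: for a homomorphism `φ` from a subgroup `A` of `E → ℤ` to `G`, with
intersection pairing `⟨x, y⟩ = ∑ e, (x e * y e) • δ e` determined by edge
lengths `δ e ∈ M`, the following are equivalent (writing `x ≤_M y` for
`y - x ∈ M`): (1) for every `x ∈ A` there are integers `m, n` with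
`m • ⟨x, x⟩ ≤_M φ x ≤_M n • ⟨x, x⟩`; (2) for every `x ∈ A` there are
`y, y' ∈ A` with `⟨x, y⟩ ≤_M φ x ≤_M ⟨x, y'⟩`. -/
theorem bounded_monodromy_iff_kkn {G E : Type*} [AddCommGroup G] [Fintype E]
    (M : AddSubmonoid G) (δ : E → G) (hδ : ∀ e, δ e ∈ M)
    (A : AddSubgroup (E → ℤ)) (φ : A →+ G) :
    (∀ x : A, ∃ m n : ℤ,
        φ x - m • (∑ e, ((x : E → ℤ) e * (x : E → ℤ) e) • δ e) ∈ M ∧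
        n • (∑ e, ((x : E → ℤ) e * (x : E → ℤ) e) • δ e) - φ x ∈ M) ↔
    (∀ x : A, ∃ y y' : A,
        φ x - (∑ e, ((x : E → ℤ) e * (y : E → ℤ) e) • δ e) ∈ M ∧
        (∑ e, ((x : E → ℤ) e * (y' : E → ℤ) e) • δ e) - φ x ∈ M) := by
  have smul_pairing (x : E → ℤ) (m : ℤ) :
      ∑ e, (x e * (m • x) e) • δ e = m • ∑ e, (x e * x e) • δ e := by
    rw [Finset.smul_sum]
    refine Finset.sum_congr rfl fun e _ => ?_
    rw [smul_smul, Pi.smul_apply, smul_eq_mul, mul_left_comm]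
  refine ⟨fun h x => ?_, fun h x => ?_⟩
  · obtain ⟨m, n, hm, hn⟩ := h x
    refine ⟨m • x, n • x, ?_⟩
    rw [AddSubgroup.coe_zsmul, AddSubgroup.coe_zsmul, smul_pairing, smul_pairing]
    exact ⟨hm, hn⟩
  · obtain ⟨y, y', hy, hy'⟩ := h x
    obtain ⟨m, hm⟩ := exists_zsmul_sum_mul_self_sub_mem M δ hδ x (-y)
    obtain ⟨n, hn⟩ := exists_zsmul_sum_mul_self_sub_mem M δ hδ x y'
    refine ⟨-m, n, ?_, ?_⟩
    · convert add_mem hy hm using 1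
      simp only [Pi.neg_apply, mul_neg, neg_smul, Finset.sum_neg_distrib]
      abel
    · convert add_mem hy' hn using 1
      abel
end

section
/- The intersection pairing of a tropical curve is positive definite: let G be an additive commutative group, M ⊆ G a submonoid (write x ≤_M y for y − x ∈ M), E a finite set, δ : E → M an assignment of edge lengths, and ⟨x, y⟩ = ∑_{e ∈ E} (x(e) · y(e)) • δ(e) ∈ G the associated intersection pairing. Then for all functions x, y : E → ℤ there exist integers m, n with m•⟨x, x⟩ ≤_M ⟨x, y⟩ and ⟨x, y⟩ ≤_M n•⟨x, x⟩; moreover 0 ≤_M ⟨x, x⟩ for every x. -/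
theorem AddSubmonoid.sum_zsmul_mem_of_nonneg {G E : Type*} [AddCommGroup G] [Fintype E]
    (M : AddSubmonoid G) {δ : E → G} (hδ : ∀ e, δ e ∈ M) {c : E → ℤ} (hc : ∀ e, 0 ≤ c e) :
    ∑ e, c e • δ e ∈ M := by
  refine M.sum_mem fun e _ => ?_
  obtain ⟨k, hk⟩ := Int.eq_ofNat_of_zero_le (hc e)
  rw [hk, natCast_zsmul]
  exact M.nsmul_mem (hδ e) k

theorem Int.abs_mul_le_mul_mul_self {a b N : ℤ} (h : |b| ≤ N) : |a * b| ≤ N * (a * a) := by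
  have ha : |a| ≤ a * a := by
    rw [← abs_mul_abs_self]
    exact (Int.le_self_sq |a|).trans_eq (sq |a|)
  calc |a * b| = |b| * |a| := by rw [abs_mul, mul_comm]
    _ ≤ N * (a * a) := mul_le_mul h ha (abs_nonneg a) ((abs_nonneg b).trans h)

/-- The intersection pairing of a tropical curve is positive definite: with
`⟨x, y⟩ = ∑ e, (x e * y e) • δ e` for edge lengths `δ e ∈ M`, for all
`x, y : E → ℤ` there are integers `m, n` with
`m • ⟨x, x⟩ ≤_M ⟨x, y⟩ ≤_M n • ⟨x, x⟩` (where `a ≤_M b` means `b - a ∈ M`);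
moreover `0 ≤_M ⟨x, x⟩` for every `x`. -/
theorem intersection_pairing_positive_definite {G E : Type*} [AddCommGroup G] [Fintype E]
    (M : AddSubmonoid G) (δ : E → G) (hδ : ∀ e, δ e ∈ M) :
    (∀ x y : E → ℤ, ∃ m n : ℤ,
        (∑ e, (x e * y e) • δ e) - m • (∑ e, (x e * x e) • δ e) ∈ M ∧
        n • (∑ e, (x e * x e) • δ e) - (∑ e, (x e * y e) • δ e) ∈ M) ∧
    (∀ x : E → ℤ, (∑ e, (x e * x e) • δ e) ∈ M) := by
  refine ⟨fun x y => ?_, fun x => M.sum_zsmul_mem_of_nonneg hδ fun e => mul_self_nonneg (x e)⟩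
  have hN (e : E) : |x e * y e| ≤ (∑ i, |y i|) * (x e * x e) :=
    Int.abs_mul_le_mul_mul_self
      (Finset.single_le_sum (f := fun i => |y i|) (fun i _ => abs_nonneg (y i))
        (Finset.mem_univ e))
  refine ⟨-∑ i, |y i|, ∑ i, |y i|, ?_, ?_⟩ <;>
    simp only [Finset.smul_sum, smul_smul, ← Finset.sum_sub_distrib, ← sub_smul] <;>
    refine M.sum_zsmul_mem_of_nonneg hδ fun e => ?_ <;>
    linarith [(abs_le.mp (hN e)).1, (abs_le.mp (hN e)).2]
end

section
/- Bounded monodromy is independent of the choice of monodromy representative: let G be an additive commutative group, M ⊆ G a submonoid (write x ≤_M y for y − x ∈ M), E a finite set, δ : E → M an assignment of edge lengths, A a subgroup of the group of functions E → ℤ, and ⟨x, y⟩ = ∑_{e ∈ E} (x(e) · y(e)) • δ(e) ∈ G the associated intersection pairing. Let φ, ψ : A → G be additive homomorphisms such that for some function z : E → ℤ one has ψ(x) = φ(x) + ⟨z, x⟩ for all x ∈ A. Then φ has bounded monodromy if and only if ψ has bounded monodromy, where an additive homomorphism χ : A → G has bounded monodromy if for every x ∈ A there exist integers m, n with m•⟨x,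 x⟩ ≤_M χ(x) and χ(x) ≤_M n•⟨x, x⟩. -/
/-- A bound on `z` bounds the pairing `⟨z, x⟩` from below by a multiple of `⟨x, x⟩`. -/
theorem zsmul_sum_mul_self_add_sum_mul_mem {G E : Type*} [AddCommGroup G] [Fintype E]
    {M : AddSubmonoid G} {δ : E → G} (hδ : ∀ e, δ e ∈ M) {k : ℤ} {z : E → ℤ}
    (hk : ∀ e, |z e| ≤ k) (x : E → ℤ) :
    k • (∑ e, (x e * x e) • δ e) + ∑ e, (z e * x e) • δ e ∈ M := by
  rw [Finset.smul_sum, ← Finset.sum_add_distrib]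
  refine M.sum_mem fun e _ => ?_
  have hnonneg : 0 ≤ k * (x e * x e) + z e * x e := by
    have h₁ : |z e * x e| ≤ k * (x e * x e) := by
      rw [abs_mul, ← abs_mul_abs_self (x e)]
      exact mul_le_mul (hk e) ((Int.le_self_sq _).trans_eq (sq _)) (abs_nonneg _)
        ((abs_nonneg _).trans (hk e))
    linarith [neg_abs_le (z e * x e)]
  rw [smul_smul, ← add_smul]
  lift k * (x e * x e) + z e * x e to ℕ using hnonneg with c
  rw [natCast_zsmul]
  exact M.nsmul_mem (hδ e) c

/-- Adding `⟨z, ·⟩` preserves bounded monodromy. -/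
theorem bounded_add_sum_mul {G E : Type*} [AddCommGroup G] [Fintype E]
    {M : AddSubmonoid G} {δ : E → G} (hδ : ∀ e, δ e ∈ M) (z x : E → ℤ) {a b : G}
    (hab : b = a + ∑ e, (z e * x e) • δ e)
    (ha : ∃ m n : ℤ, a - m • (∑ e, (x e * x e) • δ e) ∈ M ∧
      n • (∑ e, (x e * x e) • δ e) - a ∈ M) :
    ∃ m n : ℤ, b - m • (∑ e, (x e * x e) • δ e) ∈ M ∧
      n • (∑ e, (x e * x e) • δ e) - b ∈ M := by
  obtain ⟨m, n, hm, hn⟩ := ha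
  have hk : ∀ e, |z e| ≤ ∑ i, |z i| := fun e =>
    Finset.single_le_sum (f := fun i => |z i|) (fun i _ => abs_nonneg (z i)) (Finset.mem_univ e)
  have hlower := zsmul_sum_mul_self_add_sum_mul_mem hδ hk x
  have hupper := zsmul_sum_mul_self_add_sum_mul_mem hδ (z := -z)
    (fun e => by simpa using hk e) x
  simp only [Pi.neg_apply, neg_mul, neg_smul, Finset.sum_neg_distrib] at hupper
  refine ⟨m - ∑ i, |z i|, n + ∑ i, |z i|, ?_, ?_⟩
  · convert M.add_mem hm hlower using 1
    rw [hab, sub_smul]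
    abel
  · convert M.add_mem hn hupper using 1
    rw [hab, add_smul]
    abel


/-- Bounded monodromy is independent of the choice of monodromy representative:
if `φ, ψ : A →+ G` differ by `⟨z, -⟩` for some `z : E → ℤ`, where
`⟨x, y⟩ = ∑ e, (x e * y e) • δ e` is the intersection pairing determined by edge
lengths `δ e ∈ M`, then `φ` has bounded monodromy iff `ψ` does (a homomorphism
`χ` has bounded monodromy if for every `x ∈ A` there are integers `m, n` with
`m • ⟨x, x⟩ ≤_M χ x ≤_M n • ⟨x, x⟩`, where `a ≤_M b` means `b - a ∈ M`). -/
theorem bounded_monodromy_independent_of_representative {G E : Type*}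
    [AddCommGroup G] [Fintype E]
    (M : AddSubmonoid G) (δ : E → G) (hδ : ∀ e, δ e ∈ M)
    (A : AddSubgroup (E → ℤ)) (φ ψ : A →+ G) (z : E → ℤ)
    (hz : ∀ x : A, ψ x = φ x + ∑ e, (z e * (x : E → ℤ) e) • δ e) :
    ((∀ x : A, ∃ m n : ℤ,
        φ x - m • (∑ e, ((x : E → ℤ) e * (x : E → ℤ) e) • δ e) ∈ M ∧
        n • (∑ e, ((x : E → ℤ) e * (x : E → ℤ) e) • δ e) - φ x ∈ M) ↔
     (∀ x : A, ∃ m n : ℤ,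
        ψ x - m • (∑ e, ((x : E → ℤ) e * (x : E → ℤ) e) • δ e) ∈ M ∧
        n • (∑ e, ((x : E → ℤ) e * (x : E → ℤ) e) • δ e) - ψ x ∈ M)) := by
  refine ⟨fun h x => bounded_add_sum_mul hδ z x (hz x) (h x),
    fun h x => bounded_add_sum_mul hδ (-z) x ?_ (h x)⟩
  simp [hz x]
end
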